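/- Let a, b, c, r, s, t be real numbers, let V_n = V_n(a,b,c;r,s,t) be the generalized Tribonacci sequence, let U_n = V_n(0,0,1;r,s,t), and let Q_{v,n} = V_n + V_{n+1}·i + V_{n+2}·j + V_{n+3}·k be the generalized Tribonacci quaternion. Then for every n ≥ 0, Q_{v,n+2} = Q_{v,2}·U_{n+2} + (s·Q_{v,1} + t·Q_{v,0})·U_{n+1} + t·Q_{v,1}·U_n. -/

import Mathlib

/-- The generalized Tribonacci sequence `V n = V n (a,b,c;r,s,t)`. -/
def genTribonacci (a b c r s t : ℝ) : ℕ → ℝ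
  | 0 => a
  | 1 => b
  | 2 => c
  | (n+3) => r * genTribonacci a b c r s t (n+2) + s * genTribonacci a b c r s t (n+1)
      + t * genTribonacci a b c r s t n

/-- The generalized Tribonacci quaternion `Q_{v,n} = V_n + V_{n+1} i + V_{n+2} j + V_{n+3} k`. -/
noncomputable def genTribonacciQuat (a b c r s t : ℝ) (n : ℕ) : Quaternion ℝ :=
  ⟨genTribonacci a b c r s t n, genTribonacci a b c r s t (n+1),
    genTribonacci a b c r s t (n+2), genTribonacci a b c r s t (n+3)⟩

theorem genTribonacci_add_three (a b c r s t : ℝ) (n : ℕ) :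
    genTribonacci a b c r s t (n + 3) = r * genTribonacci a b c r s t (n + 2)
      + s * genTribonacci a b c r s t (n + 1) + t * genTribonacci a b c r s t n := by
  rw [genTribonacci]

/-- Addition formula for the generalized Tribonacci sequence. -/
theorem genTribonacci_add_add_two (a b c r s t : ℝ) (n m : ℕ) :
    genTribonacci a b c r s t (n + 2 + m) =
      genTribonacci 0 0 1 r s t (n + 2) * genTribonacci a b c r s t (m + 2)
        + genTribonacci 0 0 1 r s t (n + 1) *
            (s * genTribonacci a b c r s t (m + 1) + t * genTribonacci a b c r s t m)
        + t * genTribonacci 0 0 1 r s t n * genTribonacci a b c r s t (m + 1) := by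
  induction n generalizing m with
  | zero => simp [genTribonacci, add_comm]
  | succ n ih =>
    have h := ih (m + 1)
    rw [show n + 2 + (m + 1) = n + 1 + 2 + m by ring, show m + 1 + 2 = m + 3 by ring,
      show m + 1 + 1 = m + 2 by ring, genTribonacci_add_three a b c] at h
    rw [h, show n + 1 + 2 = n + 3 by ring, show n + 1 + 1 = n + 2 by ring,
      genTribonacci_add_three 0 0 1]
    ring

theorem genTribonacciQuat_re (a b c r s t : ℝ) (n : ℕ) :
    (genTribonacciQuat a b c r s t n).re = genTribonacci a b c r s t n :=
  rfl

theorem genTribonacciQuat_imI (a b c r s t : ℝ) (n : ℕ) :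
    (genTribonacciQuat a b c r s t n).imI = genTribonacci a b c r s t (n + 1) :=
  rfl

theorem genTribonacciQuat_imJ (a b c r s t : ℝ) (n : ℕ) :
    (genTribonacciQuat a b c r s t n).imJ = genTribonacci a b c r s t (n + 2) :=
  rfl

theorem genTribonacciQuat_imK (a b c r s t : ℝ) (n : ℕ) :
    (genTribonacciQuat a b c r s t n).imK = genTribonacci a b c r s t (n + 3) :=
  rfl

theorem genTribonacciQuat_eq_comb (a b c r s t : ℝ) (n : ℕ) :
    genTribonacciQuat a b c r s t (n + 2) =
      genTribonacci 0 0 1 r s t (n + 2) • genTribonacciQuat a b c r s t 2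
        + genTribonacci 0 0 1 r s t (n + 1) •
            (s • genTribonacciQuat a b c r s t 1 + t • genTribonacciQuat a b c r s t 0)
        + (t * genTribonacci 0 0 1 r s t n) • genTribonacciQuat a b c r s t 1 := by
  ext
  · simpa [genTribonacciQuat_re, mul_add] using genTribonacci_add_add_two a b c r s t n 0
  · simpa [genTribonacciQuat_imI, mul_add] using genTribonacci_add_add_two a b c r s t n 1
  · simpa [genTribonacciQuat_imJ, mul_add] using genTribonacci_add_add_two a b c r s t n 2
  · simpa [genTribonacciQuat_imK, mul_add] using genTribonacci_add_add_two a b c r s t n 3
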